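/- arXiv:0807.2137 — 2 statements merged into one kernel-verified Lean document; each statement's English description precedes it below -/
import Mathlib

section
/- Let P be a line-free polyhedron in ℝ^d with o ∉ aff P, and set hom(P) := cone(P) ∪ rec(P). Then hom(P) is a polyhedral cone (a convex cone with apex o that is an intersection of finitely many closed halfspaces through the origin) and hom(P) is pointed, i.e. it contains no straight line. -/
open scoped RealInnerProductSpace Pointwise
open Metric Set

noncomputable section

/-- Euclidean space ℝ^d. -/
abbrev E (d : ℕ) : Type := EuclideanSpace ℝ (Fin d)

/-- Evaluation of a multivariate polynomial at a point of ℝ^d. -/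
def evalPoly {d : ℕ} (p : MvPolynomial (Fin d) ℝ) (x : E d) : ℝ :=
  MvPolynomial.eval (fun i => x i) p

/-- A polytope: the convex hull of a (nonempty) finite point set. -/
def IsPolytope {d : ℕ} (P : Set (E d)) : Prop :=
  ∃ V : Finset (E d), V.Nonempty ∧ P = convexHull ℝ (V : Set (E d))

/-- A polyhedron: a nonempty intersection of finitely many closed halfspaces. -/
def IsPolyhedron {d : ℕ} (P : Set (E d)) : Prop :=
  P.Nonempty ∧ ∃ (m : ℕ) (a : Fin m → E d) (b : Fin m → ℝ),
    P = {x : E d | ∀ i, ⟪a i, x⟫ ≤ b i}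

/-- Dimension of a set: the dimension of its affine hull. -/
def dimS {d : ℕ} (A : Set (E d)) : ℕ :=
  Module.finrank ℝ (affineSpan ℝ A).direction

/-- Faces of a polytope (= exposed subsets). -/
def IsFaceOf {d : ℕ} (P F : Set (E d)) : Prop := IsExposed ℝ P F

/-- A facet of an n-dimensional polytope: an (n−1)-dimensional face. -/
def IsFacetOf {d : ℕ} (P F : Set (E d)) : Prop :=
  IsExposed ℝ P F ∧ dimS F + 1 = dimS P

/-- A vertex: a 0-dimensional face. -/
def IsVertexOf {d : ℕ} (P : Set (E d)) (v : E d) : Prop := IsExposed ℝ P {v}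

/-- Support function h(P,u). -/
def suppF {d : ℕ} (P : Set (E d)) (u : E d) : ℝ := sSup ((fun x => ⟪u, x⟫) '' P)

/-- Exposed face F(P,u) of P in direction u. -/
def exposedSet {d : ℕ} (P : Set (E d)) (u : E d) : Set (E d) :=
  {x ∈ P | ⟪u, x⟫ = suppF P u}

/-- The unit outer normal u_F(P) of a facet G of P, parallel to aff P. -/
def outerNormal {d : ℕ} (P G : Set (E d)) : E d :=
  Classical.epsilon fun u : E d =>
    u ∈ (affineSpan ℝ P).direction ∧ ‖u‖ = 1 ∧ exposedSet P u = G

/-- q_G(P,x) := (h(P,u_G(P)) − ⟨u_G(P),x⟩)/diam(P). -/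
def qF {d : ℕ} (P G : Set (E d)) (x : E d) : ℝ :=
  (suppF P (outerNormal P G) - ⟪outerNormal P G, x⟫) / Metric.diam P

/-- Conical hull: all nonnegative combinations of points of A. -/
def coneHull {d : ℕ} (A : Set (E d)) : Set (E d) :=
  {x | ∃ (n : ℕ) (c : Fin n → ℝ) (p : Fin n → E d),
    (∀ i, 0 ≤ c i) ∧ (∀ i, p i ∈ A) ∧ x = ∑ i, c i • p i}

/-- Supporting cone S(P,v) := cone (P − v). -/
def suppCone {d : ℕ} (P : Set (E d)) (v : E d) : Set (E d) :=
  coneHull ((fun x => x - v) '' P)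

/-- F⁻(P,x): the facets of P visible from x. -/
def visFacets {d : ℕ} (P : Set (E d)) (x : E d) : Set (Set (E d)) :=
  {G | IsFacetOf P G ∧ qF P G x ≤ 0}

/-- The facets of P containing the set A. -/
def facetsCont {d : ℕ} (P A : Set (E d)) : Set (Set (E d)) :=
  {G | IsFacetOf P G ∧ A ⊆ G}

/-- u_G(P): the normalized sum of the outer facet normals over facets containing G. -/
def uface {d : ℕ} (P G : Set (E d)) : E d :=
  ‖∑ᶠ F ∈ facetsCont P G, outerNormal P F‖⁻¹ • ∑ᶠ F ∈ facetsCont P G, outerNormal P F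

/-- The hyperplane H_v(P) := {x : ⟨x, u_v(P)⟩ = −1}. -/
def Hv {d : ℕ} (P : Set (E d)) (v : E d) : Set (E d) :=
  {x : E d | ⟪x, uface P {v}⟫ = -1}

/-- P_v := S(P,v) ∩ H_v(P). -/
def vertFig {d : ℕ} (P : Set (E d)) (v : E d) : Set (E d) :=
  suppCone P v ∩ Hv P v

/-- S_ρ(P,v) := cone((P_v + B(o,ρ)) ∩ H_v(P)). -/
def Srho {d : ℕ} (P : Set (E d)) (v : E d) (ρ : ℝ) : Set (E d) :=
  coneHull ((vertFig P v + Metric.closedBall (0 : E d) ρ) ∩ Hv P v)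

/-- Condition 𝒜(P): Hausdorff distance between P and {x ∈ aff P : g_l(x) ≥ 0} tends to 0. -/
def condA {d : ℕ} (P : Set (E d)) (g : ℕ → MvPolynomial (Fin d) ℝ) : Prop :=
  Filter.Tendsto
    (fun l => Metric.hausdorffDist P
      {x ∈ (affineSpan ℝ P : Set (E d)) | 0 ≤ evalPoly (g l) x})
    Filter.atTop (nhds 0)

/-- Condition ℐ(P): each g_l vanishes on all vertices of P. -/
def condI {d : ℕ} (P : Set (E d)) (g : ℕ → MvPolynomial (Fin d) ℝ) : Prop :=
  ∀ (l : ℕ) (v : E d), IsVertexOf P v → evalPoly (g l) v = 0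

/-- Condition 𝒞(P): each g_l is strictly concave on aff P. -/
def condC {d : ℕ} (P : Set (E d)) (g : ℕ → MvPolynomial (Fin d) ℝ) : Prop :=
  ∀ l : ℕ, StrictConcaveOn ℝ (affineSpan ℝ P : Set (E d)) (evalPoly (g l))
/-- The recession cone rec(P) := {u : P + u ⊆ P}. -/
def recCone {d : ℕ} (P : Set (E d)) : Set (E d) := {u : E d | ∀ x ∈ P, x + u ∈ P}

/-- hom(P) := cone(P) ∪ rec(P). -/
def homP {d : ℕ} (P : Set (E d)) : Set (E d) := coneHull P ∪ recCone P

lemma exists_w {d : ℕ} (P : Set (E d)) (hne : P.Nonempty)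
    (ho : (0 : E d) ∉ (affineSpan ℝ P : Set (E d))) :
    ∃ w : E d, ∀ x ∈ P, ⟪w, x⟫ = 1 := by
  obtain ⟨p, hp⟩ := hne
  have hpS : p ∈ affineSpan ℝ P := subset_affineSpan ℝ P hp
  have hpD : p ∉ (affineSpan ℝ P).direction := by
    intro h
    apply ho
    have := AffineSubspace.vadd_mem_of_mem_direction (Submodule.neg_mem _ h) hpS
    simpa using this
  have : ∃ v ∈ (affineSpan ℝ P).directionᗮ, ⟪v, p⟫ ≠ 0 := by
    by_contra! hcon
    apply hpD
    rw [← Submodule.orthogonal_orthogonal (affineSpan ℝ P).direction]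
    exact (Submodule.mem_orthogonal _ _).2 hcon
  obtain ⟨v, hv, hvp⟩ := this
  refine ⟨(⟪v, p⟫)⁻¹ • v, fun x hx => ?_⟩
  have hxp : x - p ∈ (affineSpan ℝ P).direction :=
    AffineSubspace.vsub_mem_direction (subset_affineSpan ℝ P hx) hpS
  have h0 : ⟪v, x - p⟫ = 0 := by
    rw [real_inner_comm]
    exact (Submodule.mem_orthogonal _ _).1 hv _ hxp
  rw [inner_sub_right] at h0
  have h1 : ⟪v, x⟫ = ⟪v, p⟫ := by linarith
  rw [real_inner_smul_left, h1, inv_mul_cancel₀ hvp]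

lemma bdd_mul {s b c : ℝ} (h : ∀ n : ℕ, c + n * s ≤ b) : s ≤ 0 := by
  by_contra! hs
  obtain ⟨n, hn⟩ := exists_nat_gt ((b - c) / s)
  rw [div_lt_iff₀ hs] at hn
  linarith [h n]

lemma bdd_mul_real {s b c : ℝ} (h : ∀ t : ℝ, c + t * s ≤ b) : s = 0 := by
  apply le_antisymm (bdd_mul fun n => h n)
  have := bdd_mul (s := -s) (b := b) (c := c) fun n => by linarith [h (-n)]
  linarith

lemma homP_eq {d m : ℕ} (a : Fin m → E d) (b : Fin m → ℝ) (w : E d) (P : Set (E d))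
    (hne : P.Nonempty) (hP : P = {x : E d | ∀ i, ⟪a i, x⟫ ≤ b i})
    (hw : ∀ x ∈ P, ⟪w, x⟫ = 1) :
    homP P = {x : E d | 0 ≤ ⟪w, x⟫ ∧ ∀ i, ⟪a i, x⟫ ≤ b i * ⟪w, x⟫} := by
  have hmem : ∀ x, x ∈ P ↔ ∀ i, ⟪a i, x⟫ ≤ b i := fun x => by rw [hP]; rfl
  ext x
  constructor
  · rintro (⟨n, c, p, hc, hp, rfl⟩ | hx)
    · have e : ⟪w, ∑ i, c i • p i⟫ = ∑ i, c i := by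
        rw [inner_sum]
        exact Finset.sum_congr rfl fun i _ => by
          rw [real_inner_smul_right, hw _ (hp i), mul_one]
      refine ⟨?_, fun i => ?_⟩
      · rw [e]; exact Finset.sum_nonneg fun i _ => hc i
      · rw [e, inner_sum, Finset.mul_sum]
        refine Finset.sum_le_sum fun j _ => ?_
        rw [real_inner_smul_right, mul_comm (b i)]
        exact mul_le_mul_of_nonneg_left ((hmem _).1 (hp j) i) (hc j)
    · obtain ⟨p, hp⟩ := hne
      have hn : ∀ n : ℕ, p + (n : ℝ) • x ∈ P := by
        intro n
        induction n with
        | zero => simpa using hp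
        | succ k ih =>
          have := hx _ ih
          rw [add_assoc] at this
          push_cast
          rwa [add_smul, one_smul]
      have h0 : ⟪w, x⟫ = 0 := by
        have h1 := hw _ (hx p hp)
        rw [inner_add_right, hw p hp] at h1
        linarith
      refine ⟨h0.ge, fun i => ?_⟩
      rw [h0, mul_zero]
      apply bdd_mul (b := b i) (c := ⟪a i, p⟫)
      intro n
      have := (hmem _).1 (hn n) i
      rwa [inner_add_right, real_inner_smul_right] at this
  · rintro ⟨h0, h⟩
    rcases h0.eq_or_lt with h0 | h0
    · right
      intro y hy
      rw [hmem] at hy ⊢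
      intro i
      have := h i
      rw [← h0, mul_zero] at this
      rw [inner_add_right]
      linarith [hy i]
    · left
      refine ⟨1, fun _ => ⟪w, x⟫, fun _ => (⟪w, x⟫)⁻¹ • x, fun _ => h0.le, fun _ => ?_, ?_⟩
      · rw [hmem]
        intro i
        rw [real_inner_smul_right, inv_mul_le_iff₀ h0, mul_comm]
        exact h i
      · simp [smul_smul, mul_inv_cancel₀ h0.ne']

/-- For a line-free polyhedron P with o ∉ aff P, hom(P) is a pointed
polyhedral cone: a convex cone with apex o, an intersection of finitely many closed
halfspaces through the origin, containing no straight line. -/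
theorem homP_pointed_polyhedral_cone {d : ℕ} (P : Set (E d)) (hP : IsPolyhedron P)
    (hlf : ∀ x u : E d, u ≠ 0 → ∃ t : ℝ, x + t • u ∉ P)
    (ho : (0 : E d) ∉ (affineSpan ℝ P : Set (E d))) :
    (Convex ℝ (homP P) ∧ ∀ c : ℝ, 0 ≤ c → ∀ x ∈ homP P, c • x ∈ homP P) ∧
    (∃ (m : ℕ) (a : Fin m → E d), homP P = {x : E d | ∀ i, ⟪a i, x⟫ ≤ 0}) ∧
    (∀ x u : E d, u ≠ 0 → ∃ t : ℝ, x + t • u ∉ homP P) := by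
  obtain ⟨hne, m, a, b, hPe⟩ := hP
  obtain ⟨w, hw⟩ := exists_w P hne ho
  have hmem : ∀ x, x ∈ P ↔ ∀ i, ⟪a i, x⟫ ≤ b i := fun x => by rw [hPe]; rfl
  rw [homP_eq a b w P hne hPe hw]
  refine ⟨⟨?_, ?_⟩, ?_, ?_⟩
  · rintro x ⟨hx0, hx⟩ y ⟨hy0, hy⟩ s t hs ht -
    simp only [Set.mem_setOf_eq, inner_add_right, real_inner_smul_right]
    refine ⟨by positivity, fun i => ?_⟩
    linarith [mul_le_mul_of_nonneg_left (hx i) hs, mul_le_mul_of_nonneg_left (hy i) ht]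
  · rintro c hc x ⟨hx0, hx⟩
    simp only [Set.mem_setOf_eq, real_inner_smul_right]
    refine ⟨by positivity, fun i => ?_⟩
    linarith [mul_le_mul_of_nonneg_left (hx i) hc]
  · refine ⟨m + 1, Fin.cons (-w) fun i => a i - b i • w, ?_⟩
    ext x
    simp [Fin.forall_fin_succ, inner_sub_left, real_inner_smul_left]
  · intro x u hu
    by_contra! hcon
    simp only [Set.mem_setOf_eq, inner_add_right, real_inner_smul_right] at hcon
    have h0 : ⟪w, u⟫ = 0 := by
      have := bdd_mul_real (s := -⟪w, u⟫) (c := -⟪w, x⟫) (b := 0)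
        fun t => by linarith [(hcon t).1]
      linarith
    have hi : ∀ i, ⟪a i, u⟫ = 0 := fun i =>
      bdd_mul_real (c := ⟪a i, x⟫) (b := b i * ⟪w, x⟫) fun t => by
        have := (hcon t).2 i
        rwa [h0, mul_zero, add_zero] at this
    obtain ⟨p, hp⟩ := hne
    obtain ⟨t, ht⟩ := hlf p u hu
    apply ht
    rw [hmem] at hp ⊢
    intro i
    rw [inner_add_right, real_inner_smul_right, hi i, mul_zero, add_zero]
    exact hp i
end
end

section
/- Let P be an n-dimensional polytope in ℝ^d and let G be a proper nonempty face of P. Then F(P, u_G(P)) = G, i.e. the exposed face of P in the direction u_G(P) equals G. -/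
open scoped RealInnerProductSpace Pointwise
open Metric Set

noncomputable section

theorem dir_inner_zero {d : ℕ} {S : Set (E d)} {b : E d} {c : ℝ}
    (h : ∀ y ∈ S, ⟪b, y⟫ = c) {w : E d} (hw : w ∈ (affineSpan ℝ S).direction) :
    ⟪b, w⟫ = 0 := by
  rw [direction_affineSpan] at hw
  have hle : vectorSpan ℝ S ≤ LinearMap.ker (innerSL ℝ b : E d →L[ℝ] ℝ).toLinearMap := by
    rw [vectorSpan_def, Submodule.span_le]
    rintro _ ⟨y, hy, z, hz, rfl⟩
    simp [inner_sub_right, h y hy, h z hz]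
  simpa using hle hw

theorem hull_le {d : ℕ} {V : Set (E d)} {a : E d} {c : ℝ}
    (h : ∀ v ∈ V, ⟪a, v⟫ ≤ c) {y : E d} (hy : y ∈ convexHull ℝ V) : ⟪a, y⟫ ≤ c := by
  have hc : Convex ℝ {y : E d | ⟪a, y⟫ ≤ c} :=
    convex_halfSpace_le (innerSL ℝ a : E d →L[ℝ] ℝ).toLinearMap.isLinear c
  exact convexHull_min h hc hy

theorem dim_lt {d : ℕ} {P F : Set (E d)} {a : E d} {c : ℝ} (hFP : F ⊆ P)
    (hF : ∀ y ∈ F, ⟪a, y⟫ = c) {g x : E d} (hg : g ∈ F) (hx : x ∈ P) (hxc : ⟪a, x⟫ ≠ c) :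
    dimS F < dimS P := by
  apply Submodule.finrank_lt_finrank_of_lt
  refine lt_of_le_of_ne (AffineSubspace.direction_le (affineSpan_mono ℝ hFP)) ?_
  intro heq
  have h1 : x - g ∈ (affineSpan ℝ P).direction :=
    AffineSubspace.vsub_mem_direction (subset_affineSpan ℝ _ hx) (subset_affineSpan ℝ _ (hFP hg))
  rw [← heq] at h1
  have := dir_inner_zero hF h1
  rw [inner_sub_right, hF g hg] at this
  exact hxc (by linarith)

theorem exists_facet {d : ℕ} (V : Finset (E d)) (G : Set (E d)) (hGne : G.Nonempty)
    (hGP : G ⊆ convexHull ℝ (V : Set (E d))) (x : E d)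
    (hx : x ∈ convexHull ℝ (V : Set (E d))) (n : ℕ) :
    ∀ (a : E d) (c : ℝ), (V.filter (fun v => ⟪a, v⟫ < c)).card = n →
      (∀ v ∈ V, ⟪a, v⟫ ≤ c) → (∀ y ∈ G, ⟪a, y⟫ = c) → ⟪a, x⟫ < c →
      ∃ F, IsFacetOf (convexHull ℝ (V : Set (E d))) F ∧ G ⊆ F ∧ x ∉ F := by
  induction n using Nat.strong_induction_on with
  | _ n ih =>
  intro a c hn hV hG hxc
  set P := convexHull ℝ (V : Set (E d)) with hPdef
  obtain ⟨g, hg⟩ := hGne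
  have hPle : ∀ y ∈ P, ⟪a, y⟫ ≤ c := fun y hy => hull_le hV hy
  set F : Set (E d) := {y ∈ P | ⟪a, y⟫ = c} with hFdef
  have hGF : G ⊆ F := fun y hy => ⟨hGP hy, hG y hy⟩
  have hgF := hGF hg
  have hFexp : IsExposed ℝ P F := by
    intro _
    refine ⟨innerSL ℝ a, ?_⟩
    ext y
    constructor
    · rintro ⟨h1, h2⟩
      refine ⟨h1, fun z hz => ?_⟩
      simpa [h2] using hPle z hz
    · rintro ⟨h1, h2⟩
      refine ⟨h1, le_antisymm (hPle y h1) ?_⟩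
      have := h2 g (hGP hg)
      simpa [hG g hg] using this
  have hlt : dimS F < dimS P := dim_lt (fun y hy => hy.1) (fun y hy => hy.2) hgF hx hxc.ne
  by_cases hdim : dimS F + 1 = dimS P
  · exact ⟨F, ⟨hFexp, hdim⟩, hGF, fun h => hxc.ne h.2⟩
  have hlt2 : dimS F + 1 < dimS P := by omega
  set W := (affineSpan ℝ (insert x F)).direction with hW
  set D := (affineSpan ℝ P).direction with hD
  have hWD : W ≤ D := AffineSubspace.direction_le
    (affineSpan_mono ℝ (insert_subset hx (fun y hy => hy.1)))
  have hWlt : Module.finrank ℝ W < Module.finrank ℝ D := by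
    refine lt_of_le_of_lt ?_ hlt2
    rw [hW, dimS, direction_affineSpan, direction_affineSpan]
    exact finrank_vectorSpan_insert_le_set ℝ F x
  have hne : Wᗮ ⊓ D ≠ ⊥ := by
    intro h
    have := Submodule.sup_orthogonal_inf_of_hasOrthogonalProjection hWD
    rw [h, sup_bot_eq] at this
    rw [this] at hWlt
    exact lt_irrefl _ hWlt
  obtain ⟨b, ⟨hbW, hbD⟩, hb0⟩ := Submodule.exists_mem_ne_zero_of_ne_bot hne
  have hbF : ∀ y ∈ F, ⟪b, y⟫ = ⟪b, x⟫ := by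
    intro y hy
    have h1 : y - x ∈ W := AffineSubspace.vsub_mem_direction
      (subset_affineSpan ℝ _ (mem_insert_of_mem _ hy)) (subset_affineSpan ℝ _ (mem_insert _ _))
    have := (Submodule.mem_orthogonal' W b).1 hbW _ h1
    rw [inner_sub_right] at this
    linarith
  have hex : ∃ v ∈ V, ⟪b, v⟫ ≠ ⟪b, x⟫ := by
    by_contra! hcon
    have hbD' : b ∈ (affineSpan ℝ (V : Set (E d))).direction := by
      rw [← affineSpan_convexHull (𝕜 := ℝ)]; exact hbD
    have := dir_inner_zero (S := (V : Set (E d))) hcon hbD'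
    exact hb0 (inner_self_eq_zero.1 this)
  -- choose the sign
  obtain ⟨b', hb'F, v0, hv0, hv0'⟩ : ∃ b' : E d, (∀ y ∈ F, ⟪b', y⟫ = ⟪b', x⟫) ∧
      ∃ v ∈ V, ⟪b', x⟫ < ⟪b', v⟫ := by
    obtain ⟨v, hv, hvne⟩ := hex
    rcases lt_or_gt_of_ne hvne with h | h
    · refine ⟨-b, fun y hy => by simp [inner_neg_left, hbF y hy], v, hv, ?_⟩
      simpa [inner_neg_left] using h
    · exact ⟨b, hbF, v, hv, h⟩
  obtain ⟨w, hw, hwmin⟩ := (V.filter (fun v => ⟪b', x⟫ < ⟪b', v⟫)).exists_min_image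
    (fun v => (c - ⟪a, v⟫) / (⟪b', v⟫ - ⟪b', x⟫)) ⟨v0, by simp [hv0, hv0']⟩
  rw [Finset.mem_filter] at hw
  set t := (c - ⟪a, w⟫) / (⟪b', w⟫ - ⟪b', x⟫) with ht
  have hwpos : 0 < ⟪b', w⟫ - ⟪b', x⟫ := sub_pos.2 hw.2
  have ht0 : 0 ≤ t := div_nonneg (sub_nonneg.2 (hV w hw.1)) hwpos.le
  have hwt : t * (⟪b', w⟫ - ⟪b', x⟫) = c - ⟪a, w⟫ := div_mul_cancel₀ _ hwpos.ne'
  have hwlt : ⟪a, w⟫ < c := by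
    refine lt_of_le_of_ne (hV w hw.1) fun h => ?_
    exact hw.2.ne' (hb'F w ⟨subset_convexHull ℝ _ hw.1, h⟩)
  have hin : ∀ y, ⟪a + t • b', y⟫ = ⟪a, y⟫ + t * ⟪b', y⟫ := by
    intro y; rw [inner_add_left, real_inner_smul_left]
  refine ih _ ?_ (a + t • b') (c + t * ⟪b', x⟫) rfl ?_ ?_ ?_
  · rw [← hn]
    apply Finset.card_lt_card
    rw [Finset.ssubset_iff_of_subset]
    · refine ⟨w, by simp [hw.1, hwlt], ?_⟩
      rw [Finset.mem_filter, hin]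
      rintro ⟨_, h⟩
      linarith
    · intro v hv
      rw [Finset.mem_filter, hin] at hv
      rw [Finset.mem_filter]
      refine ⟨hv.1, lt_of_le_of_ne (hV v hv.1) fun h => ?_⟩
      have := hb'F v ⟨subset_convexHull ℝ _ hv.1, h⟩
      rw [h, this] at hv
      exact lt_irrefl _ hv.2
  · intro v hv
    rw [hin]
    rcases le_or_gt ⟪b', v⟫ ⟪b', x⟫ with h | h
    · have := mul_le_mul_of_nonneg_left h ht0
      linarith [hV v hv]
    · have h1 := hwmin v (by simp [hv, h])
      rw [le_div_iff₀ (sub_pos.2 h)] at h1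
      linarith
  · intro y hy
    rw [hin, hG y hy, hb'F y (hGF hy)]
  · rw [hin]; linarith

theorem exposedSet_eq {d : ℕ} {P : Set (E d)} (hc : IsCompact P) (hne : P.Nonempty) (u : E d) :
    exposedSet P u = {x ∈ P | ∀ y ∈ P, ⟪u, y⟫ ≤ ⟪u, x⟫} := by
  have hcont : Continuous (fun x : E d => ⟪u, x⟫) := by fun_prop
  have hbdd : BddAbove ((fun x => ⟪u, x⟫) '' P) := (hc.image hcont).bddAbove
  ext x
  constructor
  · rintro ⟨h1, h2⟩
    refine ⟨h1, fun y hy => ?_⟩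
    rw [h2]
    exact le_csSup hbdd ⟨y, hy, rfl⟩
  · rintro ⟨h1, h2⟩
    refine ⟨h1, le_antisymm (le_csSup hbdd ⟨x, h1, rfl⟩) (csSup_le (hne.image _) ?_)⟩
    rintro _ ⟨y, hy, rfl⟩
    exact h2 y hy

theorem outerNormal_spec {d : ℕ} {P F : Set (E d)} (hc : IsCompact P) (hF : IsFacetOf P F)
    (hFne : F.Nonempty) : exposedSet P (outerNormal P F) = F := by
  have hPne : P.Nonempty := hFne.mono hF.1.subset
  suffices h : ∃ u : E d, u ∈ (affineSpan ℝ P).direction ∧ ‖u‖ = 1 ∧ exposedSet P u = F from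
    (Classical.epsilon_spec h).2.2
  obtain ⟨l, hl⟩ := hF.1 hFne
  set D := (affineSpan ℝ P).direction with hD
  set a := (InnerProductSpace.toDual ℝ (E d)).symm l with ha
  have hla : ∀ y, l y = ⟪a, y⟫ := fun y => by simp [ha]
  set p := D.starProjection a with hp
  have hpD : p ∈ D := Submodule.starProjection_apply_mem _ _
  have hdiff : ∀ y ∈ P, ∀ z ∈ P, l y ≤ l z ↔ ⟪p, y⟫ ≤ ⟪p, z⟫ := by
    intro y hy z hz
    have h1 : z - y ∈ D := AffineSubspace.vsub_mem_direction
      (subset_affineSpan ℝ _ hz) (subset_affineSpan ℝ _ hy)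
    have h2 := Submodule.starProjection_inner_eq_zero (K := D) a _ h1
    rw [← hp, inner_sub_left, inner_sub_right, inner_sub_right] at h2
    rw [hla, hla]
    constructor <;> intro h <;> linarith
  have hp0 : p ≠ 0 := by
    intro h0
    have : F = P := by
      rw [hl]
      ext y
      refine ⟨fun h => h.1, fun h => ⟨h, fun z hz => ?_⟩⟩
      rw [hdiff z hz y h, h0]; simp
    have h3 := hF.2
    rw [this] at h3
    omega
  have hnp : 0 < ‖p‖⁻¹ := inv_pos.2 (norm_pos_iff.2 hp0)
  refine ⟨‖p‖⁻¹ • p, D.smul_mem _ hpD, norm_smul_inv_norm hp0, ?_⟩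
  rw [exposedSet_eq hc hPne, hl]
  ext y
  refine and_congr_right fun hy => forall₂_congr fun z hz => ?_
  rw [hdiff z hz y hy, real_inner_smul_left, real_inner_smul_left, mul_le_mul_iff_right₀ hnp]

theorem facets_finite {d : ℕ} (V : Finset (E d)) (G : Set (E d)) :
    (facetsCont (convexHull ℝ (V : Set (E d))) G).Finite := by
  have hc : IsCompact (convexHull ℝ (V : Set (E d))) := V.finite_toSet.isCompact_convexHull ℝ
  refine Set.Finite.of_finite_image (f := fun F => F.extremePoints ℝ)
    (V.finite_toSet.finite_subsets.subset ?_) ?_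
  · rintro _ ⟨F, hF, rfl⟩
    exact hF.1.1.isExtreme.extremePoints_subset_extremePoints.trans
      extremePoints_convexHull_subset
  · intro A hA B hB h
    rw [← closure_convexHull_extremePoints (hA.1.1.isCompact hc)
      (hA.1.1.convex (convex_convexHull ℝ _)),
      ← closure_convexHull_extremePoints (hB.1.1.isCompact hc)
      (hB.1.1.convex (convex_convexHull ℝ _))]
    simp only at h
    rw [h]

/-- For a proper nonempty face G of a polytope P, the exposed face of P in
the direction u_G(P) equals G. -/
theorem exposedSet_uface {d : ℕ} (P : Set (E d)) (hP : IsPolytope P)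
    (G : Set (E d)) (hG : IsFaceOf P G) (hGne : G.Nonempty) (hGproper : G ≠ P) :
    exposedSet P (uface P G) = G := by
  obtain ⟨V, hVne, rfl⟩ := hP
  set P := convexHull ℝ (V : Set (E d)) with hPdef
  have hc : IsCompact P := V.finite_toSet.isCompact_convexHull ℝ
  have hGP : G ⊆ P := hG.subset
  have hPne : P.Nonempty := hGne.mono hGP
  have hfin : (facetsCont P G).Finite := facets_finite V G
  -- every point outside `G` is missed by a facet containing `G`
  have key : ∀ x ∈ P, x ∉ G → ∃ F ∈ facetsCont P G, x ∉ F := by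
    intro x hx hxG
    obtain ⟨l, hl⟩ := hG hGne
    obtain ⟨g, hg⟩ := hGne
    set a := (InnerProductSpace.toDual ℝ (E d)).symm l with ha
    have hla : ∀ y, l y = ⟪a, y⟫ := fun y => by simp [ha]
    have hg' := hg
    rw [hl] at hg'
    have hle : ∀ y ∈ P, ⟪a, y⟫ ≤ ⟪a, g⟫ := fun y hy => by
      rw [← hla, ← hla]; exact hg'.2 y hy
    obtain ⟨F, h1, h2, h3⟩ := exists_facet V G ⟨g, hg⟩ hGP x hx _ a ⟪a, g⟫ rfl
      (fun v hv => hle v (subset_convexHull ℝ _ hv))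
      (fun y hy => by
        have hy' := hy
        rw [hl] at hy'
        refine le_antisymm (hle y (hGP hy)) ?_
        rw [← hla, ← hla]; exact hy'.2 g (hGP hg))
      (by
        refine lt_of_le_of_ne (hle x hx) fun h => hxG ?_
        rw [hl]
        refine ⟨hx, fun y hy => ?_⟩
        rw [hla, hla, h]; exact hle y hy)
    exact ⟨F, ⟨h1, h2⟩, h3⟩
  have hN : ∀ F ∈ facetsCont P G, {x ∈ P | ∀ y ∈ P, ⟪outerNormal P F, y⟫ ≤ ⟪outerNormal P F, x⟫} = F :=
    fun F hF => by
      rw [← exposedSet_eq hc hPne]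
      exact outerNormal_spec hc hF.1 (hGne.mono hF.2)
  have hS : ∀ y, ⟪∑ᶠ F ∈ facetsCont P G, outerNormal P F, y⟫
      = ∑ F ∈ hfin.toFinset, ⟪outerNormal P F, y⟫ := by
    intro y
    rw [finsum_mem_eq_finite_toFinset_sum _ hfin, sum_inner]
  obtain ⟨g, hg⟩ := hGne
  have hmax : ∀ F ∈ facetsCont P G, ∀ z ∈ G, ∀ y ∈ P,
      ⟪outerNormal P F, y⟫ ≤ ⟪outerNormal P F, z⟫ := by
    intro F hF z hz y hy
    have := hF.2 hz
    rw [← hN F hF] at this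
    exact this.2 y hy
  have hstrict : ∀ x ∈ P, x ∉ G → ⟪∑ᶠ F ∈ facetsCont P G, outerNormal P F, x⟫
      < ⟪∑ᶠ F ∈ facetsCont P G, outerNormal P F, g⟫ := by
    intro x hx hxG
    obtain ⟨F, hF, hxF⟩ := key x hx hxG
    rw [hS, hS]
    refine Finset.sum_lt_sum (fun F' hF' => hmax F' (hfin.mem_toFinset.1 hF') g hg x hx)
      ⟨F, hfin.mem_toFinset.2 hF, ?_⟩
    by_contra! hcon
    apply hxF
    rw [← hN F hF]
    exact ⟨hx, fun y hy => (hmax F hF g hg y hy).trans hcon⟩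
  have hS0 : ∑ᶠ F ∈ facetsCont P G, outerNormal P F ≠ 0 := by
    intro h0
    apply hGproper
    refine hGP.antisymm fun x hx => ?_
    by_contra hxG
    have := hstrict x hx hxG
    rw [h0] at this
    simp at this
  have hnp : 0 < ‖∑ᶠ F ∈ facetsCont P G, outerNormal P F‖⁻¹ := inv_pos.2 (norm_pos_iff.2 hS0)
  rw [exposedSet_eq hc hPne, uface]
  ext x
  simp only [mem_setOf_eq, real_inner_smul_left, mul_le_mul_iff_right₀ hnp]
  constructor
  · rintro ⟨hx, h⟩
    by_contra hxG
    exact absurd (h g (hGP hg)) (not_le.2 (hstrict x hx hxG))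
  · intro hx
    refine ⟨hGP hx, fun y hy => ?_⟩
    rw [hS, hS]
    exact Finset.sum_le_sum fun F hF => hmax F (hfin.mem_toFinset.1 hF) x hx y hy
end
end
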